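/- Let W be a 2-dimensional complex vector space and let Z : 𝒦(W) → 𝒦(W*) be a continuous, translation invariant, SL(W,ℂ)-contravariant Minkowski valuation. Write h(ZK,u) = Σ_{i=0}^{4} f_i(K,u), where f_i is the McMullen component of degree i. Then f_0 ≡ 0 and f_4 ≡ 0; that is, h(ZK,u) = f_1(K,u) + f_2(K,u) + f_3(K,u) for all K ∈ 𝒦(W) and u ∈ W. -/

import Mathlib

open scoped Pointwise
open MeasureTheory Module

noncomputable section

section CommonDefs

variable {V V' A : Type*}
variable [NormedAddCommGroup V] [NormedSpace ℝ V]
variable [NormedAddCommGroup V'] [NormedSpace ℝ V']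
variable [NormedAddCommGroup A] [NormedSpace ℝ A]

/-- The supremum of a (pairing) functional over a convex body; used to express the
support function `h(K, ξ) = sup_{x ∈ K} ⟨ξ, x⟩` for the various pairings `p = ⟨ξ, ·⟩`. -/
def hSupp (K : ConvexBody V) (p : V → ℝ) : ℝ := sSup (p '' (K : Set V))

/-- The translate `x + K` of a convex body. -/
def ConvexBody.translate (K : ConvexBody V) (x : V) : ConvexBody V :=
  ⟨(fun y => x + y) '' (K : Set V), K.convex.translate x,
    K.isCompact.image (continuous_const.add continuous_id),
    K.nonempty.image _⟩

/-- The image of a convex body under a continuous linear map. -/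
def ConvexBody.mapCLM (f : V →L[ℝ] V') (K : ConvexBody V) : ConvexBody V' :=
  ⟨f '' (K : Set V), K.convex.linear_image (f : V →ₗ[ℝ] V'),
    K.isCompact.image f.continuous, K.nonempty.image _⟩

/-- The reflection `-K` of a convex body about the origin. -/
def ConvexBody.neg (K : ConvexBody V) : ConvexBody V :=
  K.mapCLM (-(ContinuousLinearMap.id ℝ V))

/-- The union of two convex bodies (a convex body provided it is convex). -/
def ConvexBody.union (K L : ConvexBody V) (h : Convex ℝ ((K : Set V) ∪ (L : Set V))) :
    ConvexBody V :=
  ⟨(K : Set V) ∪ (L : Set V), h, K.isCompact.union L.isCompact,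
    K.nonempty.mono Set.subset_union_left⟩

/-- The intersection of two convex bodies (a convex body provided it is nonempty). -/
def ConvexBody.inter (K L : ConvexBody V) (h : ((K : Set V) ∩ (L : Set V)).Nonempty) :
    ConvexBody V :=
  ⟨(K : Set V) ∩ (L : Set V), K.convex.inter L.convex,
    K.isCompact.inter_right L.isClosed, h⟩

/-- A Minkowski valuation: `Z(K ∪ L) + Z(K ∩ L) = Z(K) + Z(L)` (Minkowski addition)
whenever `K, L, K ∪ L` are convex bodies. -/
def IsMinkowskiValuation (Z : ConvexBody V → ConvexBody A) : Prop :=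
  ∀ (K L : ConvexBody V) (hU : Convex ℝ ((K : Set V) ∪ (L : Set V)))
    (hI : ((K : Set V) ∩ (L : Set V)).Nonempty),
    Z (K.union L hU) + Z (K.inter L hI) = Z K + Z L

/-- A real-valued valuation: `φ(K ∪ L) + φ(K ∩ L) = φ(K) + φ(L)`
whenever `K, L, K ∪ L` are convex bodies. -/
def IsValuation (φ : ConvexBody V → ℝ) : Prop :=
  ∀ (K L : ConvexBody V) (hU : Convex ℝ ((K : Set V) ∪ (L : Set V)))
    (hI : ((K : Set V) ∩ (L : Set V)).Nonempty),
    φ (K.union L hU) + φ (K.inter L hI) = φ K + φ L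

/-- Translation invariance of a map defined on convex bodies. -/
def IsTranslationInvariant {α : Type*} (Z : ConvexBody V → α) : Prop :=
  ∀ (K : ConvexBody V) (x : V), Z (K.translate x) = Z K

/-- The mixed volume (w.r.t. the Lebesgue (Haar) measure `μ`) of an `n`-tuple of convex
bodies, given by the polarization formula
`V(K₁, …, Kₙ) = (1/n!) ∑_{S ⊆ {1,…,n}} (-1)^{n - |S|} vol(∑_{i ∈ S} K_i)`. -/
def mixedVol [MeasurableSpace V] (μ : Measure V) {n : ℕ} (K : Fin n → ConvexBody V) : ℝ :=
  (n.factorial : ℝ)⁻¹ *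
    ∑ S : Finset (Fin n), (-1 : ℝ) ^ (n - S.card) * (μ (∑ i ∈ S, (K i : Set V))).toReal

/-- The extension `V(K, …, K, f)` (with `n - 1` copies of `K`) of the mixed volume to
continuous positively `1`-homogeneous functions `f` on the dual space, defined via
Aleksandrov's variational formula: `V(K,…,K,f)` is `1/n` times the right derivative at
`t = 0` of the volume of the Wulff shape (aka Aleksandrov body) of `h_K + t f`.
For `f = h_L` the Wulff shape is `K + t L`, so this indeed extends `L ↦ V(K, …, K, L)`. -/
def mixedVolFn [MeasurableSpace V] (μ : Measure V) (K : ConvexBody V)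
    (f : (V →L[ℝ] ℝ) → ℝ) : ℝ :=
  (Module.finrank ℝ V : ℝ)⁻¹ *
    derivWithin (fun t : ℝ =>
        (μ {x : V | ∀ ξ : V →L[ℝ] ℝ, ξ x ≤ hSupp K ξ + t * f ξ}).toReal)
      (Set.Ici 0) 0

/-- The dimension of a convex body: the dimension of (the direction of) its affine hull. -/
def bodyDim (K : ConvexBody V) : ℕ := Module.finrank ℝ (vectorSpan ℝ (K : Set V))

/-- A convex body contained in a subspace `E`, viewed as a convex body of `E`. -/
def bodyIn (E : Submodule ℝ V) (K : ConvexBody V) (h : (K : Set V) ⊆ (E : Set V)) :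
    ConvexBody ↥E :=
  ⟨Subtype.val ⁻¹' (K : Set V),
    K.convex.linear_preimage (E.subtype),
    by
      rw [Topology.IsEmbedding.subtypeVal.isCompact_iff,
        Set.image_preimage_eq_of_subset (by rw [Subtype.range_coe]; exact h)]
      exact K.isCompact,
    by obtain ⟨x, hx⟩ := K.nonempty; exact ⟨⟨x, h hx⟩, hx⟩⟩

/-- The properties of the components of McMullen's decomposition of (the support function
of) a Minkowski valuation: each `fᵢ(·, u)` is a continuous, translation invariant
valuation, homogeneous of degree `i`, and each `fᵢ(K, ·)` is continuous and positively
`1`-homogeneous. -/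
def McMullenProps (f : ℕ → ConvexBody V → V → ℝ) : Prop :=
  (∀ (i : ℕ) (u : V), Continuous fun K : ConvexBody V => f i K u) ∧
  (∀ (i : ℕ) (u : V), IsValuation fun K : ConvexBody V => f i K u) ∧
  (∀ (i : ℕ) (u : V), IsTranslationInvariant fun K : ConvexBody V => f i K u) ∧
  (∀ (i : ℕ) (K : ConvexBody V) (u : V) (t : ℝ), 0 < t → f i (t • K) u = t ^ i * f i K u) ∧
  (∀ (i : ℕ) (K : ConvexBody V), Continuous fun u : V => f i K u) ∧
  (∀ (i : ℕ) (K : ConvexBody V) (u : V) (t : ℝ), 0 < t → f i K (t • u) = t * f i K u)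

end CommonDefs

/-- The surface area measure `S(M, ·)` on `S¹ ⊆ ℂ` of a planar convex body `M`,
characterized (uniquely) by the property that it is a finite measure concentrated on the
unit circle with `∫_{S¹} h(L, α) dσ(α) = 2 V(M, L)` for every planar convex body `L`. -/
def IsSurfaceAreaMeasure (M : ConvexBody ℂ) (σ : Measure ℂ) : Prop :=
  IsFiniteMeasure σ ∧ σ (Metric.sphere (0 : ℂ) 1)ᶜ = 0 ∧
    ∀ L : ConvexBody ℂ,
      (∫ α, hSupp L (fun c => (c * (starRingEnd ℂ) α).re) ∂σ) = 2 * mixedVol volume ![M, L]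

section ComplexDefs

variable {W : Type*} [NormedAddCommGroup W] [NormedSpace ℂ W] [FiniteDimensional ℂ W]

/-- The determinant pairing `det(u, v)` on a 2-dimensional complex vector space,
with respect to a fixed basis `b`. -/
def cdet (b : Basis (Fin 2) ℂ W) (u v : W) : ℂ :=
  b.coord 0 u * b.coord 1 v - b.coord 1 u * b.coord 0 v

/-- `det(·, w) : W → ℂ` as a continuous real-linear map. -/
def cdetCLM (b : Basis (Fin 2) ℂ W) (w : W) : W →L[ℝ] ℂ :=
  LinearMap.toContinuousLinearMap
    (((b.coord 1 w) • (b.coord 0 : W →ₗ[ℂ] ℂ)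
      - (b.coord 0 w) • (b.coord 1 : W →ₗ[ℂ] ℂ)).restrictScalars ℝ)

/-- `det(K, w) = {det(k, w) : k ∈ K} ⊆ ℂ`. -/
def detBody (b : Basis (Fin 2) ℂ W) (K : ConvexBody W) (w : W) : ConvexBody ℂ :=
  K.mapCLM (cdetCLM b w)

/-- `N · w = {c • w : c ∈ N} ⊆ W` for a planar convex body `N ⊆ ℂ`. -/
def dotBody (N : ConvexBody ℂ) (w : W) : ConvexBody W :=
  N.mapCLM (LinearMap.toContinuousLinearMap ((LinearMap.toSpanSingleton ℂ W w).restrictScalars ℝ))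

/-- A complex-linear endomorphism, as a continuous real-linear map. -/
def cReal (g : W →ₗ[ℂ] W) : W →L[ℝ] W :=
  LinearMap.toContinuousLinearMap (g.restrictScalars ℝ)

/-- Precomposition `ξ ↦ ξ ∘ g` on the complex dual `W* = W →L[ℂ] ℂ`,
as a continuous real-linear map. The adjoint of `g` is `precompDual g`, and
`g^{-*} = precompDual g⁻¹`. -/
def precompDual (g : W →L[ℂ] W) : (W →L[ℂ] ℂ) →L[ℝ] (W →L[ℂ] ℂ) :=
  LinearMap.toContinuousLinearMap
    { toFun := fun ξ => ξ.comp g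
      map_add' := fun ξ η => ContinuousLinearMap.add_comp ξ η g
      map_smul' := fun r ξ => ContinuousLinearMap.smul_comp r ξ g }

/-- `Z : 𝒦(W) → 𝒦(W*)` is `SL(W,ℂ)`-contravariant: `Z(gK) = g^{-*} Z(K)` for every
`g ∈ SL(W,ℂ)`. -/
def IsSLContravariant (Z : ConvexBody W → ConvexBody (W →L[ℂ] ℂ)) : Prop :=
  ∀ g : W ≃L[ℂ] W, LinearMap.det ((g : W →L[ℂ] W) : W →ₗ[ℂ] W) = 1 →
    ∀ K : ConvexBody W,
      Z (K.mapCLM (cReal (g : W →ₗ[ℂ] W))) =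
        (Z K).mapCLM (precompDual (g.symm : W →L[ℂ] W))

/-- `Z : 𝒦(W) → 𝒦(W)` is `SL(W,ℂ)`-covariant: `Z(gK) = g Z(K)` for every
`g ∈ SL(W,ℂ)`. -/
def IsSLCovariant (Z : ConvexBody W → ConvexBody W) : Prop :=
  ∀ g : W ≃L[ℂ] W, LinearMap.det ((g : W →L[ℂ] W) : W →ₗ[ℂ] W) = 1 →
    ∀ K : ConvexBody W,
      Z (K.mapCLM (cReal (g : W →ₗ[ℂ] W))) = (Z K).mapCLM (cReal (g : W →ₗ[ℂ] W))

end ComplexDefs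

section Helpers

variable {V V' : Type*}
variable [NormedAddCommGroup V] [NormedSpace ℝ V]
variable [NormedAddCommGroup V'] [NormedSpace ℝ V']

/-- A Hausdorff limit of convex compact sets is convex. -/
theorem NonemptyCompacts.convex_of_tendsto {L : ℕ → TopologicalSpace.NonemptyCompacts V}
    {L₀ : TopologicalSpace.NonemptyCompacts V} (hL : ∀ n, Convex ℝ (L n : Set V))
    (h : Filter.Tendsto L Filter.atTop (nhds L₀)) : Convex ℝ (L₀ : Set V) := by
  intro x hx y hy a b ha hb hab
  rw [← L₀.isCompact.isClosed.closure_eq, Metric.mem_closure_iff]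
  intro ε hε
  obtain ⟨n, hn⟩ := ((Metric.tendsto_nhds.1 h) (ε / 2) (half_pos hε)).exists
  rw [Metric.NonemptyCompacts.dist_eq] at hn
  have hfin : Metric.hausdorffEDist (L n : Set V) (L₀ : Set V) ≠ ⊤ :=
    Metric.hausdorffEDist_ne_top_of_nonempty_of_bounded (L n).nonempty L₀.nonempty
      (L n).isCompact.isBounded L₀.isCompact.isBounded
  obtain ⟨x', hx', hxx'⟩ := Metric.exists_dist_lt_of_hausdorffDist_lt' hx hn hfin
  obtain ⟨y', hy', hyy'⟩ := Metric.exists_dist_lt_of_hausdorffDist_lt' hy hn hfin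
  obtain ⟨z, hz, hzz⟩ :=
    Metric.exists_dist_lt_of_hausdorffDist_lt (hL n hx' hy' ha hb hab) hn hfin
  refine ⟨z, hz, ?_⟩
  have hxy : dist (a • x + b • y) (a • x' + b • y') ≤ ε / 2 := by
    calc dist (a • x + b • y) (a • x' + b • y')
        ≤ dist (a • x) (a • x') + dist (b • y) (b • y') := dist_add_add_le _ _ _ _
      _ = a * dist x' x + b * dist y' y := by
        rw [dist_smul₀, dist_smul₀, Real.norm_of_nonneg ha, Real.norm_of_nonneg hb,
          dist_comm x, dist_comm y]
      _ ≤ a * (ε / 2) + b * (ε / 2) := by gcongr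
      _ = ε / 2 := by rw [← add_mul, hab, one_mul]
  linarith [dist_triangle (a • x + b • y) (a • x' + b • y') z]

/-- A continuous functional is bounded on the convex bodies contained in a compact set. -/
theorem ConvexBody.exists_abs_le_of_subset {B : Set V} (hB : IsCompact B)
    {φ : ConvexBody V → ℝ} (hφ : Continuous φ) :
    ∃ M : ℝ, 0 ≤ M ∧ ∀ K : ConvexBody V, (K : Set V) ⊆ B → |φ K| ≤ M := by
  by_contra! hcon
  choose K hKB hK using fun n : ℕ => hcon n n.cast_nonneg
  let L : ℕ → TopologicalSpace.NonemptyCompacts V :=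
    fun n => ⟨⟨K n, (K n).isCompact⟩, (K n).nonempty⟩
  obtain ⟨L₀, -, ψ, hψ, hlim⟩ :=
    (TopologicalSpace.NonemptyCompacts.isCompact_subsets_of_isCompact hB).tendsto_subseq
      (x := L) hKB
  let K₀ : ConvexBody V :=
    ⟨L₀, NonemptyCompacts.convex_of_tendsto (fun n => (K (ψ n)).convex) hlim,
      L₀.isCompact, L₀.nonempty⟩
  have hKlim : Filter.Tendsto (fun n => K (ψ n)) Filter.atTop (nhds K₀) := by
    rw [tendsto_iff_dist_tendsto_zero] at hlim ⊢
    exact hlim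
  have habs := ((hφ.tendsto K₀).comp hKlim).abs
  refine not_tendsto_nhds_of_tendsto_atTop ?_ _ habs
  exact Filter.tendsto_atTop_mono (fun n => (hK (ψ n)).le)
    (tendsto_natCast_atTop_atTop.comp hψ.tendsto_atTop)

/-- If a valuation is bounded by `M` on the parts of `K` lying in slabs of width `1`, then it is
bounded by `(2 n + 1) M` at `K` as soon as `K` lies in a slab of width `n`. -/
theorem IsValuation.abs_le_of_slabs {φ : ConvexBody V → ℝ} (hφ : IsValuation φ)
    (l : V →L[ℝ] ℝ) {M : ℝ} (hM : 0 ≤ M) (n : ℕ) (K : ConvexBody V) (a : ℝ)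
    (hP : ∀ P : ConvexBody V, (P : Set V) ⊆ K →
      (∃ c, ∀ x ∈ P, l x ∈ Set.Icc c (c + 1)) → |φ P| ≤ M)
    (hK : ∀ x ∈ K, l x ∈ Set.Icc a (a + n)) : |φ K| ≤ (2 * n + 1) * M := by
  induction n generalizing K with
  | zero =>
    refine (hP K subset_rfl ⟨a, fun x hx => ?_⟩).trans (by simp)
    have := hK x hx
    simp only [Nat.cast_zero, add_zero, Set.mem_Icc] at this
    exact ⟨this.1, by linarith⟩
  | succ n ih =>
    have hlow : Convex ℝ {x | l x ≤ a + n} := convex_halfSpace_le l.toLinearMap.isLinear _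
    have hupp : Convex ℝ {x | a + n ≤ l x} := convex_halfSpace_ge l.toLinearMap.isLinear _
    have clow : IsClosed {x | l x ≤ a + n} := isClosed_le l.continuous continuous_const
    have cupp : IsClosed {x | a + n ≤ l x} := isClosed_le continuous_const l.continuous
    by_cases h1 : ((K : Set V) ∩ {x | l x ≤ a + n}).Nonempty
    · by_cases h2 : ((K : Set V) ∩ {x | a + n ≤ l x}).Nonempty
      · let K₁ : ConvexBody V := ⟨_, K.convex.inter hlow, K.isCompact.inter_right clow, h1⟩
        let K₂ : ConvexBody V := ⟨_, K.convex.inter hupp, K.isCompact.inter_right cupp, h2⟩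
        have hUeq : (K₁ : Set V) ∪ (K₂ : Set V) = K := by
          change ((K : Set V) ∩ _) ∪ ((K : Set V) ∩ _) = K
          rw [← Set.inter_union_distrib_left, Set.inter_eq_left]
          exact fun x _ => le_total (l x) (a + n)
        have hI : ((K₁ : Set V) ∩ (K₂ : Set V)).Nonempty := by
          obtain ⟨x, hxK, hx⟩ := h1
          obtain ⟨y, hyK, hy⟩ := h2
          obtain ⟨z, hz, hlz⟩ :=
            K.convex.isPreconnected.intermediate_value hxK hyK l.continuous.continuousOn ⟨hx, hy⟩
          exact ⟨z, ⟨hz, hlz.le⟩, hz, hlz.ge⟩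
        have hU : Convex ℝ ((K₁ : Set V) ∪ (K₂ : Set V)) := hUeq ▸ K.convex
        have hval := hφ K₁ K₂ hU hI
        rw [show K₁.union K₂ hU = K from ConvexBody.ext hUeq] at hval
        have e1 : |φ K₁| ≤ (2 * n + 1) * M :=
          ih K₁ (fun P h => hP P (h.trans Set.inter_subset_left))
            fun x hx => ⟨(hK x hx.1).1, hx.2⟩
        have hb : ∀ P : ConvexBody V, (P : Set V) ⊆ K₂ → |φ P| ≤ M := fun P h =>
          hP P (h.trans Set.inter_subset_left) ⟨a + n, fun x hx => ⟨(h hx).2, by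
            have := (hK x (h hx).1).2
            push_cast at this
            linarith⟩⟩
        have e2 := hb K₂ subset_rfl
        have e3 := hb (K₁.inter K₂ hI) Set.inter_subset_right
        rw [abs_le] at e1 e2 e3 ⊢
        push_cast
        constructor <;> linarith
      · have := ih K hP fun x hx => ⟨(hK x hx).1, le_of_not_ge fun h => h2 ⟨x, hx, h⟩⟩
        push_cast
        linarith
    · have := hP K subset_rfl ⟨a + n, fun x hx => ⟨le_of_not_ge fun h => h1 ⟨x, hx, h⟩, by
        have := (hK x hx).2
        push_cast at this
        linarith⟩⟩
      push_cast
      nlinarith [mul_nonneg n.cast_nonneg hM]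

theorem hSupp_mapCLM (F : V →L[ℝ] V') (K : ConvexBody V) (p : V' → ℝ) :
    hSupp (K.mapCLM F) p = hSupp K (fun x => p (F x)) := by
  change sSup (p '' (F '' (K : Set V))) = _
  rw [Set.image_image]
  rfl

theorem ConvexBody.mapCLM_smul (F : V →L[ℝ] V') (K : ConvexBody V) (t : ℝ) :
    (t • K).mapCLM F = t • K.mapCLM F := by
  ext1
  change F '' (t • (K : Set V)) = t • (F '' (K : Set V))
  exact image_smul_set F t (K : Set V)

theorem ConvexBody.mapCLM_zero (F : V →L[ℝ] V') : (0 : ConvexBody V).mapCLM F = 0 := by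
  ext1
  change F '' ({0} : Set V) = {0}
  simp

/-- The dilates `K / (n + 1)` converge to the origin. -/
theorem ConvexBody.tendsto_inv_smul_zero (K : ConvexBody V) :
    Filter.Tendsto (fun n : ℕ => ((n : ℝ) + 1)⁻¹ • K) Filter.atTop (nhds 0) := by
  obtain ⟨R, hR, hK⟩ := K.isBounded.exists_pos_norm_le
  have hlim : Filter.Tendsto (fun n : ℕ => ((n : ℝ) + 1)⁻¹ * R) Filter.atTop (nhds 0) := by
    simpa [one_div] using (tendsto_one_div_add_atTop_nhds_zero_nat (𝕜 := ℝ)).mul_const R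
  rw [tendsto_iff_dist_tendsto_zero]
  refine squeeze_zero (fun _ => dist_nonneg) (fun n => ?_) hlim
  have hn : (0 : ℝ) ≤ ((n : ℝ) + 1)⁻¹ := by positivity
  have hd : ∀ y ∈ K, dist (((n : ℝ) + 1)⁻¹ • y) 0 ≤ ((n : ℝ) + 1)⁻¹ * R := fun y hy => by
    rw [dist_zero_right, norm_smul, Real.norm_of_nonneg hn]
    exact mul_le_mul_of_nonneg_left (hK y hy) hn
  refine Metric.hausdorffDist_le_of_mem_dist (by positivity) ?_ ?_
  · rintro _ ⟨y, hy, rfl⟩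
    exact ⟨0, rfl, hd y hy⟩
  · rintro _ rfl
    obtain ⟨y, hy⟩ := K.nonempty
    exact ⟨_, ⟨y, hy, rfl⟩, dist_comm (0 : V) _ ▸ hd y hy⟩

end Helpers

section ComplexHelpers

theorem exists_basis_apply_zero {W : Type*} [NormedAddCommGroup W] [NormedSpace ℂ W]
    (hW : Module.finrank ℂ W = 2) {u : W} (hu : u ≠ 0) :
    ∃ b : Basis (Fin 2) ℂ W, b 0 = u := by
  obtain ⟨v, hv⟩ := exists_linearIndependent_pair_of_one_lt_finrank (R := ℂ)
    (by rw [hW]; norm_num) hu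
  exact ⟨basisOfLinearIndependentOfCardEqFinrank hv (by simp [hW]), by simp⟩

variable {W : Type*} [NormedAddCommGroup W] [NormedSpace ℂ W] [FiniteDimensional ℂ W]

/-- The McMullen components of an `SL(W,ℂ)`-contravariant valuation are contravariant. -/
theorem McMullenProps.apply_mapCLM {Z : ConvexBody W → ConvexBody (W →L[ℂ] ℂ)}
    (hZg : IsSLContravariant Z) {f : ℕ → ConvexBody W → W → ℝ} (hf : McMullenProps f)
    (hsum : ∀ (K : ConvexBody W) (u : W),
      hSupp (Z K) (fun ξ => (ξ u).re) = ∑ i ∈ Finset.range 5, f i K u)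
    (g : W ≃L[ℂ] W) (hg : LinearMap.det ((g : W →L[ℂ] W) : W →ₗ[ℂ] W) = 1)
    (K : ConvexBody W) (u : W) :
    f 0 (K.mapCLM (cReal (g : W →ₗ[ℂ] W))) u = f 0 K (g.symm u) ∧
      f 4 (K.mapCLM (cReal (g : W →ₗ[ℂ] W))) u = f 4 K (g.symm u) := by
  have key : ∀ t : ℝ, 0 < t →
      ∑ i ∈ Finset.range 5, t ^ i * f i (K.mapCLM (cReal (g : W →ₗ[ℂ] W))) u =
        ∑ i ∈ Finset.range 5, t ^ i * f i K (g.symm u) := by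
    intro t ht
    simp only [← hf.2.2.2.1 _ _ _ t ht]
    rw [← hsum, ← hsum, ← ConvexBody.mapCLM_smul, hZg g hg, hSupp_mapCLM]
    rfl
  have h1 := key 1 (by norm_num)
  have h2 := key 2 (by norm_num)
  have h3 := key 3 (by norm_num)
  have h4 := key 4 (by norm_num)
  have h5 := key 5 (by norm_num)
  norm_num [Finset.sum_range_succ] at h1 h2 h3 h4 h5
  constructor <;> linarith

/-- The complex-linear equivalence acting diagonally as `(w 0, w 1)` in the basis `b`. -/
def diagEquiv (b : Basis (Fin 2) ℂ W) (w : Fin 2 → ℂˣ) : W ≃L[ℂ] W :=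
  (b.equiv (b.unitsSMul w) (Equiv.refl _)).toContinuousLinearEquiv

theorem diagEquiv_basis (b : Basis (Fin 2) ℂ W) (w : Fin 2 → ℂˣ) (i : Fin 2) :
    diagEquiv b w (b i) = (w i : ℂ) • b i := by
  change b.equiv (b.unitsSMul w) (Equiv.refl _) (b i) = _
  simp [Basis.unitsSMul_apply, Units.smul_def]

theorem det_diagEquiv (b : Basis (Fin 2) ℂ W) (w : Fin 2 → ℂˣ) :
    LinearMap.det ((diagEquiv b w : W →L[ℂ] W) : W →ₗ[ℂ] W) = w 0 * w 1 := by
  rw [← LinearMap.det_toMatrix b, Matrix.det_fin_two]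
  simp [LinearMap.toMatrix_apply, diagEquiv_basis]

theorem coord_diagEquiv (b : Basis (Fin 2) ℂ W) (w : Fin 2 → ℂˣ) (i : Fin 2) (x : W) :
    b.coord i (diagEquiv b w x) = w i * b.coord i x := by
  conv_lhs => rw [← b.sum_repr x]
  simp only [map_sum, map_smul, diagEquiv_basis]
  fin_cases i <;> simp [Fin.sum_univ_two, mul_comm]

/-- The diagonal map `(r⁻¹, r)`, an element of `SL(W,ℂ)`. -/
theorem exists_hyperbolic (b : Basis (Fin 2) ℂ W) {r : ℝ} (hr : 0 < r) :
    ∃ g : W ≃L[ℂ] W, LinearMap.det ((g : W →L[ℂ] W) : W →ₗ[ℂ] W) = 1 ∧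
      g.symm (b 0) = r • b 0 ∧ (∀ x, b.coord 0 (g x) = (r : ℂ)⁻¹ * b.coord 0 x) ∧
      ∀ x, b.coord 1 (g x) = r * b.coord 1 x := by
  have hrc : (r : ℂ) ≠ 0 := by exact_mod_cast hr.ne'
  let w : Fin 2 → ℂˣ := ![(Units.mk0 (r : ℂ) hrc)⁻¹, Units.mk0 (r : ℂ) hrc]
  refine ⟨diagEquiv b w, ?_, ?_, fun x => ?_, fun x => ?_⟩
  · rw [det_diagEquiv]
    simp [w, hrc]
  · rw [ContinuousLinearEquiv.symm_apply_eq, ← Complex.coe_smul, map_smul, diagEquiv_basis,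
      smul_smul]
    simp [w, hrc]
  · rw [coord_diagEquiv]
    simp [w]
  · rw [coord_diagEquiv]
    simp [w]

/-- A continuous translation invariant valuation grows at most quadratically along
bodies with bounded first and linearly growing second complex coordinate. -/
theorem IsValuation.exists_abs_le_sq (b : Basis (Fin 2) ℂ W) {φ : ConvexBody W → ℝ}
    (hφ : IsValuation φ) (hφc : Continuous φ) (hφt : IsTranslationInvariant φ) (R : ℝ) :
    ∃ M : ℝ, 0 ≤ M ∧ ∀ (N : ℕ) (K : ConvexBody W), (∀ x ∈ K, ‖b.coord 0 x‖ ≤ R) →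
      (∀ x ∈ K, ‖b.coord 1 x‖ ≤ N) → |φ K| ≤ (4 * N + 1) ^ 2 * M := by
  let F : ℂ × ℂ → W := fun p => p.1 • b 0 + p.2 • b 1
  have hF : Continuous F := by fun_prop
  obtain ⟨M, hM, hMφ⟩ := ConvexBody.exists_abs_le_of_subset
    (((isCompact_closedBall (0 : ℂ) R).prod (isCompact_closedBall (0 : ℂ) 2)).image hF) hφc
  let l : W →L[ℝ] ℂ := LinearMap.toContinuousLinearMap ((b.coord 1).restrictScalars ℝ)
  have hl : ∀ x, l x = b.coord 1 x := fun _ => rfl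
  have hunit : ∀ P : ConvexBody W, (∀ x ∈ P, ‖b.coord 0 x‖ ≤ R) →
      (∃ c, ∀ x ∈ P, (Complex.reCLM ∘L l) x ∈ Set.Icc c (c + 1)) →
      (∃ d, ∀ x ∈ P, (Complex.imCLM ∘L l) x ∈ Set.Icc d (d + 1)) → |φ P| ≤ M := by
    rintro P hP ⟨c, hc⟩ ⟨d, hd⟩
    rw [← hφt P (-((⟨c, d⟩ : ℂ) • b 1))]
    refine hMφ _ ?_
    rintro _ ⟨x, hx, rfl⟩
    refine ⟨(b.coord 0 x, b.coord 1 x - ⟨c, d⟩), ⟨by simpa using hP x hx, ?_⟩, ?_⟩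
    · have h1 := hc x hx
      have h2 := hd x hx
      simp only [ContinuousLinearMap.comp_apply, Complex.reCLM_apply, Complex.imCLM_apply, hl,
        Set.mem_Icc] at h1 h2
      rw [mem_closedBall_zero_iff]
      refine (Complex.norm_le_abs_re_add_abs_im _).trans ?_
      have e1 : |(b.coord 1 x - ⟨c, d⟩ : ℂ).re| ≤ 1 := by
        rw [Complex.sub_re, abs_le]; constructor <;> linarith
      have e2 : |(b.coord 1 x - ⟨c, d⟩ : ℂ).im| ≤ 1 := by
        rw [Complex.sub_im, abs_le]; constructor <;> linarith
      linarith
    · have hx := b.sum_repr x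
      rw [Fin.sum_univ_two] at hx
      simp only [F, Basis.coord_apply, sub_smul]
      nth_rewrite 3 [← hx]
      abel
  refine ⟨M, hM, fun N K h0 h1 => ?_⟩
  have habs : ∀ {y : ℝ}, |y| ≤ N → y ∈ Set.Icc (-(N : ℝ)) (-N + (2 * N : ℕ)) := fun h => by
    rw [abs_le] at h
    push_cast
    exact ⟨h.1, by linarith⟩
  have hstep : ∀ P : ConvexBody W, (P : Set W) ⊆ K →
      (∃ c, ∀ x ∈ P, (Complex.reCLM ∘L l) x ∈ Set.Icc c (c + 1)) →
      |φ P| ≤ (2 * (2 * N : ℕ) + 1) * M := by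
    rintro P hPK ⟨c, hc⟩
    refine hφ.abs_le_of_slabs (Complex.imCLM ∘L l) hM _ P (-N) (fun Q hQP hQ => ?_) fun x hx =>
      habs ((Complex.abs_im_le_norm _).trans (h1 x (hPK hx)))
    exact hunit Q (fun x hx => h0 x (hPK (hQP hx))) ⟨c, fun x hx => hc x (hQP hx)⟩ hQ
  have hfin := hφ.abs_le_of_slabs (Complex.reCLM ∘L l) (by positivity) _ K (-N) hstep fun x hx =>
    habs ((Complex.abs_re_le_norm _).trans (h1 x hx))
  refine hfin.trans_eq ?_
  push_cast
  ring

end ComplexHelpers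

/-- Let `W` be a 2-dimensional complex vector space and
`Z : 𝒦(W) → 𝒦(W*)` a continuous, translation invariant, `SL(W,ℂ)`-contravariant
Minkowski valuation, with McMullen components `f i`, so that
`h(Z K, u) = ∑_{i=0}^{4} fᵢ(K, u)`. Then `f₀ ≡ 0` and `f₄ ≡ 0`; that is,
`h(Z K, u) = f₁(K,u) + f₂(K,u) + f₃(K,u)` for all `K ∈ 𝒦(W)` and `u ∈ W`. -/
theorem degrees_zero_and_four_vanish
    {W : Type*} [NormedAddCommGroup W] [NormedSpace ℂ W] [FiniteDimensional ℂ W]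
    (hW : Module.finrank ℂ W = 2)
    (Z : ConvexBody W → ConvexBody (W →L[ℂ] ℂ))
    (hZc : Continuous Z) (hZt : IsTranslationInvariant Z)
    (hZv : IsMinkowskiValuation Z) (hZg : IsSLContravariant Z)
    (f : ℕ → ConvexBody W → W → ℝ) (hf : McMullenProps f)
    (hsum : ∀ (K : ConvexBody W) (u : W),
      hSupp (Z K) (fun ξ => (ξ u).re) = ∑ i ∈ Finset.range 5, f i K u) :
    (∀ (K : ConvexBody W) (u : W), f 0 K u = 0) ∧
    (∀ (K : ConvexBody W) (u : W), f 4 K u = 0) ∧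
    (∀ (K : ConvexBody W) (u : W),
      hSupp (Z K) (fun ξ => (ξ u).re) = f 1 K u + f 2 K u + f 3 K u) := by
  have hu0 : ∀ i K, f i K 0 = 0 := fun i K => by
    have := hf.2.2.2.2.2 i K 0 2 two_pos
    rw [smul_zero] at this
    linarith
  have h0 : ∀ (K : ConvexBody W) (u : W), f 0 K u = 0 := by
    intro K u
    have hK : f 0 K u = f 0 0 u := by
      refine tendsto_nhds_unique ?_ (((hf.1 0 u).tendsto 0).comp K.tendsto_inv_smul_zero)
      refine tendsto_const_nhds.congr fun n => ?_
      simpa using (hf.2.2.2.1 0 K u ((n : ℝ) + 1)⁻¹ (by positivity)).symm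
    rw [hK]
    rcases eq_or_ne u 0 with rfl | hu
    · exact hu0 0 0
    obtain ⟨b, rfl⟩ := exists_basis_apply_zero hW hu
    obtain ⟨g, hg, hgu, -⟩ := exists_hyperbolic b two_pos
    have := (hf.apply_mapCLM hZg hsum g hg 0 (b 0)).1
    rw [ConvexBody.mapCLM_zero, hgu, hf.2.2.2.2.2 0 0 (b 0) 2 two_pos] at this
    linarith
  have h4 : ∀ (K : ConvexBody W) (u : W), f 4 K u = 0 := by
    intro K u
    rcases eq_or_ne u 0 with rfl | hu
    · exact hu0 4 K
    obtain ⟨b, rfl⟩ := exists_basis_apply_zero hW hu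
    have hbdd : ∀ i, ∃ R : ℝ, ∀ x ∈ K, ‖b.coord i x‖ ≤ R := fun i =>
      K.isCompact.exists_bound_of_continuousOn
        (LinearMap.continuous_of_finiteDimensional (b.coord i)).continuousOn
    obtain ⟨R, hR⟩ := hbdd 0
    obtain ⟨R', hR'⟩ := hbdd 1
    obtain ⟨N, hN⟩ := exists_nat_ge R'
    obtain ⟨M, hM, hbound⟩ := IsValuation.exists_abs_le_sq b (hf.2.1 4 (b 0)) (hf.1 4 (b 0))
      (hf.2.2.1 4 (b 0)) R
    have hgrowth : ∀ m : ℕ, 0 < m → m * |f 4 K (b 0)| ≤ (4 * N + 1) ^ 2 * M := by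
      intro m hm
      have hm' : (0 : ℝ) < m := by exact_mod_cast hm
      have hm1 : (1 : ℝ) ≤ m := by exact_mod_cast hm
      have hmc : (m : ℂ) ≠ 0 := by exact_mod_cast hm.ne'
      obtain ⟨g, hg, hgu, hg0, hg1⟩ := exists_hyperbolic b hm'
      have hscale : f 4 ((m : ℝ) • K.mapCLM (cReal (g : W →ₗ[ℂ] W))) (b 0)
          = (m : ℝ) ^ 4 * (m * f 4 K (b 0)) := by
        rw [hf.2.2.2.1 4 _ _ _ hm', (hf.apply_mapCLM hZg hsum g hg K (b 0)).2, hgu,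
          hf.2.2.2.2.2 4 _ _ _ hm']
      have hle := hbound (m ^ 2 * N) ((m : ℝ) • K.mapCLM (cReal (g : W →ₗ[ℂ] W))) ?_ ?_
      · simp only [hscale] at hle
        rw [abs_mul, abs_mul, Nat.abs_cast, abs_of_pos (by positivity : (0 : ℝ) < (m : ℝ) ^ 4)]
          at hle
        have hsq : (4 * ((m ^ 2 * N : ℕ) : ℝ) + 1) ^ 2 ≤ (m : ℝ) ^ 4 * (4 * N + 1) ^ 2 := by
          have : (4 * ((m ^ 2 * N : ℕ) : ℝ) + 1) ≤ (m : ℝ) ^ 2 * (4 * N + 1) := by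
            push_cast
            nlinarith
          calc _ ≤ ((m : ℝ) ^ 2 * (4 * N + 1)) ^ 2 := by gcongr
            _ = _ := by ring
        refine le_of_mul_le_mul_left ?_ (by positivity : (0 : ℝ) < (m : ℝ) ^ 4)
        rw [← mul_assoc _ _ M]
        exact hle.trans (mul_le_mul_of_nonneg_right hsq hM)
      · rintro _ ⟨_, ⟨x, hx, rfl⟩, rfl⟩
        change ‖b.coord 0 ((m : ℝ) • g x)‖ ≤ R
        rw [← Complex.coe_smul, map_smul, hg0, smul_eq_mul, Complex.ofReal_natCast,
          mul_inv_cancel_left₀ hmc]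
        exact hR x hx
      · rintro _ ⟨_, ⟨x, hx, rfl⟩, rfl⟩
        change ‖b.coord 1 ((m : ℝ) • g x)‖ ≤ _
        rw [← Complex.coe_smul, map_smul, hg1, smul_eq_mul, Complex.ofReal_natCast, ← mul_assoc,
          norm_mul, norm_mul, Complex.norm_natCast]
        push_cast
        rw [sq]
        gcongr
        exact (hR' x hx).trans hN
    by_contra hne
    obtain ⟨m, hm⟩ := exists_nat_gt ((4 * N + 1) ^ 2 * M / |f 4 K (b 0)|)
    rw [div_lt_iff₀ (abs_pos.2 hne)] at hm
    rcases Nat.eq_zero_or_pos m with rfl | hpos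
    · have : 0 ≤ (4 * (N : ℝ) + 1) ^ 2 * M := by positivity
      simp only [Nat.cast_zero, zero_mul] at hm
      linarith
    · linarith [hgrowth m hpos]
  refine ⟨h0, h4, fun K u => ?_⟩
  rw [hsum]
  simp [Finset.sum_range_succ, h0, h4]
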